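/- arXiv:1410.5506 — 2 statements merged into one kernel-verified Lean document; each statement's English description precedes it below -/
import Mathlib

section
/- If p is a polynomial with real coefficients whose Gaussian expectation vanishes, i.e. ∫_ℝ p(x)·exp(−x²/2) dx = 0, then there exists a polynomial q with real coefficients such that p(X) = q'(X) − X·q(X). That is, every degree-zero element of the homotopy Gaussian with expectation zero is exact. -/
open Polynomial MeasureTheory

theorem exists_eq_derivative_sub_X_mul_add_C_X_pow {R : Type*} [CommRing R] (n : ℕ) :
    ∃ (q : R[X]) (c : R), X ^ n = derivative q - X * q + C c := by
  induction n using Nat.twoStepInduction with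
  | zero => exact ⟨0, 1, by simp⟩
  | one => exact ⟨-1, 0, by simp⟩
  | more n ih _ =>
    obtain ⟨q, c, hq⟩ := ih
    refine ⟨C ((n : R) + 1) * q - X ^ (n + 1), ((n : R) + 1) * c, ?_⟩
    simp only [derivative_sub, derivative_C_mul, derivative_X_pow, C_mul, Nat.add_sub_cancel,
      Nat.cast_add, Nat.cast_one]
    linear_combination C ((n : R) + 1) * hq

/-- Every polynomial is a constant up to an exact polynomial. -/
theorem exists_eq_derivative_sub_X_mul_add_C {R : Type*} [CommRing R] (p : R[X]) :
    ∃ (q : R[X]) (c : R), p = derivative q - X * q + C c := by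
  induction p using Polynomial.induction_on' with
  | add p₁ p₂ h₁ h₂ =>
    obtain ⟨q₁, c₁, h₁⟩ := h₁
    obtain ⟨q₂, c₂, h₂⟩ := h₂
    refine ⟨q₁ + q₂, c₁ + c₂, ?_⟩
    rw [derivative_add, C_add]
    linear_combination h₁ + h₂
  | monomial n a =>
    obtain ⟨q, c, hq⟩ := exists_eq_derivative_sub_X_mul_add_C_X_pow (R := R) n
    refine ⟨C a * q, a * c, ?_⟩
    rw [← C_mul_X_pow_eq_monomial, derivative_C_mul, C_mul]
    linear_combination C a * hq

theorem integrable_eval_mul_exp_neg_sq_div_two (p : ℝ[X]) :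
    Integrable fun x : ℝ ↦ p.eval x * Real.exp (-x ^ 2 / 2) := by
  induction p using Polynomial.induction_on' with
  | add p₁ p₂ h₁ h₂ => simpa only [eval_add, add_mul] using h₁.fun_add h₂
  | monomial n a =>
    have h := (integrable_rpow_mul_exp_neg_mul_sq (b := 1 / 2) (by norm_num)
      (s := n) (by linarith [n.cast_nonneg (α := ℝ)])).const_mul a
    refine h.congr (.of_forall fun x ↦ ?_)
    simp only [eval_monomial, Real.rpow_natCast, mul_assoc]
    ring_nf

theorem hasDerivAt_eval_mul_exp_neg_sq_div_two (q : ℝ[X]) (x : ℝ) :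
    HasDerivAt (fun x : ℝ ↦ q.eval x * Real.exp (-x ^ 2 / 2))
      ((derivative q - X * q).eval x * Real.exp (-x ^ 2 / 2)) x := by
  have h : HasDerivAt (fun x : ℝ ↦ -x ^ 2 / 2) (-x) x :=
    ((hasDerivAt_pow 2 x).fun_neg.div_const 2).congr_deriv (by norm_num; ring)
  refine ((q.hasDerivAt x).mul h.exp).congr_deriv ?_
  simp only [eval_sub, eval_mul, eval_X]
  ring

/-- The Gaussian expectation vanishes on exact polynomials. -/
theorem integral_derivative_sub_X_mul_eval_mul_exp (q : ℝ[X]) :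
    ∫ x : ℝ, (derivative q - X * q).eval x * Real.exp (-x ^ 2 / 2) = 0 :=
  integral_eq_zero_of_hasDerivAt_of_integrable (hasDerivAt_eval_mul_exp_neg_sq_div_two q)
    (integrable_eval_mul_exp_neg_sq_div_two _) (integrable_eval_mul_exp_neg_sq_div_two q)

/-- Every polynomial with vanishing Gaussian expectation is exact for the
homotopy Gaussian differential: if `∫ p(x)·exp(-x²/2) dx = 0` then
`p = q' − X·q` for some polynomial `q`. -/
theorem exact_of_gaussian_expectation_zero (p : Polynomial ℝ)
    (h : (∫ x : ℝ, p.eval x * Real.exp (-x ^ 2 / 2)) = 0) :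
    ∃ q : Polynomial ℝ, p = derivative q - X * q := by
  obtain ⟨q, c, rfl⟩ := exists_eq_derivative_sub_X_mul_add_C p
  have hpos : 0 < ∫ x : ℝ, Real.exp (-x ^ 2 / 2) :=
    integral_exp_pos (by simpa using integrable_eval_mul_exp_neg_sq_div_two 1)
  have hc := integrable_eval_mul_exp_neg_sq_div_two (C c)
  simp only [eval_add (q := C c), add_mul] at h
  rw [integral_add (integrable_eval_mul_exp_neg_sq_div_two _) hc,
    integral_derivative_sub_X_mul_eval_mul_exp, zero_add] at h
  simp only [eval_C, integral_const_mul] at h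
  obtain rfl : c = 0 := (mul_eq_zero.mp h).resolve_right hpos.ne'
  exact ⟨q, by simp⟩
end

section
/- For every n ≥ 1, define the polynomial qₙ = −Σ_{j=1}^{⌈n/2⌉} ((n−1)!!/(n+1−2j)!!)·X^{n+1−2j} with rational (hence real) coefficients. Then qₙ' − X·qₙ = Xⁿ − mₙ, where mₙ = (n−1)!! if n is even and mₙ = 0 if n is odd. (In the homotopy Gaussian, setting yₙ = qₙ·η, this says d(yₙ) = xⁿ − E(xⁿ).) -/
open Polynomial Nat

/-- The explicit primitive `qₙ = −Σ_{j=1}^{⌈n/2⌉} ((n−1)‼/(n+1−2j)‼)·X^(n+1−2j)`. -/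
noncomputable def homotopyGaussianQ (n : ℕ) : Polynomial ℝ :=
  -(∑ j ∈ Finset.Icc 1 ((n + 1) / 2),
      C (((n - 1)‼ : ℝ) / ((n + 1 - 2 * j)‼ : ℝ)) * X ^ (n + 1 - 2 * j))

/-- The `n`-th Gaussian moment `mₙ = (n−1)‼` for `n` even, `0` for `n` odd. -/
noncomputable def gaussianMoment (n : ℕ) : ℝ := if Even n then ((n - 1)‼ : ℝ) else 0

theorem doubleFactorial_add_one_eq_mul_sub_one (n : ℕ) :
    (n + 1)‼ = (n + 1) * (n - 1)‼ := by
  cases n with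
  | zero => rfl
  | succ k => exact Nat.doubleFactorial_add_two k

theorem homotopyGaussianQ_add_two (n : ℕ) :
    homotopyGaussianQ (n + 2) = C ((n : ℝ) + 1) * homotopyGaussianQ n - X ^ (n + 1) := by
  have hpos : ((n + 1)‼ : ℝ) ≠ 0 := by exact_mod_cast (Nat.doubleFactorial_pos (n + 1)).ne'
  have hdiv : (n + 2 + 1) / 2 = (n + 1) / 2 + 1 := by omega
  unfold homotopyGaussianQ
  rw [hdiv, ← Finset.Ico_add_one_right_eq_Icc, ← Finset.Ico_add_one_right_eq_Icc,
    Finset.sum_eq_sum_Ico_succ_bot (by omega), ← Finset.sum_Ico_add', mul_neg, Finset.mul_sum,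
    neg_add, neg_add_eq_sub]
  have hlead : C (((n + 2 - 1)‼ : ℝ) / ((n + 2 + 1 - 2 * 1)‼ : ℝ)) * X ^ (n + 2 + 1 - 2 * 1) =
      (X ^ (n + 1) : Polynomial ℝ) := by
    simp [div_self hpos]
  rw [hlead]
  congr 2
  refine Finset.sum_congr rfl fun j _ => ?_
  have hexp : n + 2 + 1 - 2 * (j + 1) = n + 1 - 2 * j := by omega
  rw [hexp, ← mul_assoc, ← C_mul, show n + 2 - 1 = n + 1 from rfl,
    doubleFactorial_add_one_eq_mul_sub_one]
  push_cast
  rw [mul_div_assoc]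

theorem gaussianMoment_add_two (n : ℕ) :
    gaussianMoment (n + 2) = ((n : ℝ) + 1) * gaussianMoment n := by
  simp [gaussianMoment, Nat.even_add, doubleFactorial_add_one_eq_mul_sub_one]

theorem derivative_sub_X_mul_homotopyGaussianQ_of_nat (n : ℕ) :
    derivative (homotopyGaussianQ n) - X * homotopyGaussianQ n =
      X ^ n - C (gaussianMoment n) := by
  induction n using Nat.twoStepInduction with
  | zero => simp [homotopyGaussianQ, gaussianMoment]
  | one => simp [homotopyGaussianQ, gaussianMoment]
  | more n ih _ =>
    rw [homotopyGaussianQ_add_two, gaussianMoment_add_two, derivative_sub, derivative_C_mul,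
      derivative_X_pow, C_mul]
    push_cast
    linear_combination C ((n : ℝ) + 1) * ih

/-- For `n ≥ 1`, `qₙ' − X·qₙ = Xⁿ − mₙ`; i.e. in the homotopy Gaussian,
`d(qₙ·η) = xⁿ − E(xⁿ)`. -/
theorem derivative_sub_X_mul_homotopyGaussianQ (n : ℕ) (hn : 1 ≤ n) :
    derivative (homotopyGaussianQ n) - X * homotopyGaussianQ n =
      X ^ n - C (gaussianMoment n) := by
  exact derivative_sub_X_mul_homotopyGaussianQ_of_nat n
end
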